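/- arXiv:1808.02680 — 2 statements merged into one kernel-verified Lean document; each statement's English description precedes it below -/
import Mathlib

section
/- Let ξ_a be the fixed point beginning with the letter a of the endomorphism of {a,b,c}* defined by a ↦ ababcababca, b ↦ ababcababcaab, c ↦ ababc. Then there do not exist two finite words u and v such that ξ_a is an infinite concatenation of copies of u and v, i.e., ξ_a ∉ {u, v}^ω for every choice of finite words u and v. -/
section LSPDefs

variable {A : Type*} {B : Type*}

/-- `u` is a prefix of the infinite word `w`. -/
def IsPrefixI (u : List A) (w : ℕ → A) : Prop :=
  ∀ (i : ℕ) (h : i < u.length), u.get ⟨i, h⟩ = w i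

/-- `u` is a factor of the infinite word `w`. -/
def IsFactorI (u : List A) (w : ℕ → A) : Prop :=
  ∃ k : ℕ, ∀ (i : ℕ) (h : i < u.length), u.get ⟨i, h⟩ = w (k + i)

/-- `u` is a left special factor of the infinite word `w`. -/
def LeftSpecialI (u : List A) (w : ℕ → A) : Prop :=
  ∃ a b : A, a ≠ b ∧ IsFactorI (a :: u) w ∧ IsFactorI (b :: u) w

/-- An infinite word is LSP if all its left special factors are prefixes of it. -/
def IsLSP (w : ℕ → A) : Prop :=
  ∀ u : List A, LeftSpecialI u w → IsPrefixI u w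

/-- Application of a morphism (given by images of letters) to a finite word. -/
def applyM (f : A → List B) (u : List A) : List B := (u.map f).flatten

/-- The prefix of length `n` of an infinite word. -/
def infPrefix (w : ℕ → A) (n : ℕ) : List A := List.ofFn (fun i : Fin n => w i)

/-- `x` is the image of the infinite word `w` under the morphism `f`. -/
def InfImage (f : A → List B) (w : ℕ → A) (x : ℕ → B) : Prop :=
  ∀ n : ℕ, IsPrefixI (applyM f (infPrefix w n)) x

/-- `f` is a basic LSP (bLSP) endomorphism. -/
def IsBLSP (f : A → List A) : Prop :=
  ∃ α : A, f α = [α] ∧ ∀ β : A, β ≠ α → ∃ γ : A, f β = f γ ++ [β]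

/-- `f` is an R-bLSP morphism with domain alphabet `D`: the restriction to `D` of a
bLSP morphism `g` (letters outside the domain are sent to `[]`). -/
def IsRBLSPOn (D : Set A) (f : A → List A) : Prop :=
  (∀ x : A, x ∈ D ↔ f x ≠ []) ∧ ∃ g : A → List A, IsBLSP g ∧ ∀ x ∈ D, f x = g x

/-- The episturmian morphism `L_α`. -/
def Lmor [DecidableEq A] (α : A) : A → List A := fun β => if β = α then [α] else [α, β]

/-- `u` is an `(a,b,c,β,γ)`-fragility of `w`. -/
def Frag5 (w : ℕ → A) (a b c β γ : A) (u : List A) : Prop :=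
  IsPrefixI (u ++ [a]) w ∧ IsFactorI (β :: (u ++ [b])) w ∧ IsFactorI (γ :: (u ++ [c])) w

/-- `w` is `(a,b,c)`-fragile. -/
def Fragile (w : ℕ → A) (a b c : A) : Prop :=
  ∃ (u : List A) (β γ : A), β ≠ γ ∧ Frag5 w a b c β γ u

/-- `f` is LSP `(a,b,c)`-breaking (for words over the domain `D` of `f`). -/
def Breaking (D : Set A) (f : A → List A) (a b c : A) : Prop :=
  ∀ (w x : ℕ → A), Set.range w ⊆ D → IsLSP w → Fragile w a b c →
    InfImage f w x → ¬ IsLSP x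

/-- Length of the longest common prefix of two finite words. -/
noncomputable def lcpLen (u v : List A) : ℕ :=
  sSup {n | n ≤ u.length ∧ n ≤ v.length ∧ u.take n = v.take n}

/-- A morphism is nonerasing if images of letters are nonempty. -/
def Nonerasing (f : A → List B) : Prop := ∀ a : A, f a ≠ []

/-- `f` preserves the LSP property for infinite words. -/
def PreservesLSP (f : A → List B) : Prop :=
  ∀ (w : ℕ → A) (x : ℕ → B), IsLSP w → InfImage f w x → IsLSP x

/-- `f ∈ U(A,B)`: nonerasing and each letter of `B` occurs at most once in total
among the images of letters. -/
def InU [Fintype A] [DecidableEq B] (f : A → List B) : Prop :=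
  Nonerasing f ∧ ∀ b : B, (∑ a : A, (f a).count b) ≤ 1

/-- `u^k`. -/
def listPow (u : List B) (k : ℕ) : List B := (List.replicate k u).flatten

/-- `x = u^ω`. -/
def IsOmegaPow (u : List B) (x : ℕ → B) : Prop := ∀ k : ℕ, IsPrefixI (listPow u k) x

/-- `f ∈ P_LSP(A,B)`: nonerasing, all images are positive powers of a word `u`
with `u^ω` LSP. -/
def InPLSP (f : A → List B) : Prop :=
  Nonerasing f ∧ ∃ u : List B, u ≠ [] ∧ (∀ a : A, ∃ k : ℕ, 0 < k ∧ f a = listPow u k) ∧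
    ∀ x : ℕ → B, IsOmegaPow u x → IsLSP x

/-- `r` is the primitive root of `w`. -/
def IsPrimRoot (r w : List B) : Prop :=
  (∃ k : ℕ, 0 < k ∧ w = listPow r k) ∧
  ∀ (v : List B) (k : ℕ), 0 < k → w = listPow v k → r.length ≤ v.length

/-- Compatibility of a chain of morphisms `[g_1, …, g_n]` (composition
`g_1 ∘ ⋯ ∘ g_n`): every letter produced by `g_{i+1}` lies in the domain of `g_i`. -/
def CompatChain (L : List (B → List B)) : Prop :=
  List.Chain' (fun g h => ∀ x y, y ∈ h x → g y ≠ []) L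

end LSPDefs

/-- The morphism `f_a = λ_{abc} ∘ λ_{bca} ∘ λ_{cab}` on `{a,b,c}` (with `a = 0`,
`b = 1`, `c = 2`): `a ↦ ababcababca`, `b ↦ ababcababcaab`, `c ↦ ababc`. -/
def famor : Fin 3 → List (Fin 3) :=
  ![[0, 1, 0, 1, 2, 0, 1, 0, 1, 2, 0],
    [0, 1, 0, 1, 2, 0, 1, 0, 1, 2, 0, 0, 1],
    [0, 1, 0, 1, 2]]

/-- weight of a finite word -/
def wt (N : Fin 3 → ℤ) (l : List (Fin 3)) : ℤ := (l.map N).sum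

lemma wt_append (N : Fin 3 → ℤ) (l m : List (Fin 3)) : wt N (l ++ m) = wt N l + wt N m := by
  simp [wt]

lemma wt_count (N : Fin 3 → ℤ) (l : List (Fin 3)) :
    wt N l = l.count 0 * N 0 + l.count 1 * N 1 + l.count 2 * N 2 := by
  induction l with
  | nil => simp [wt]
  | cons a l ih =>
    have : wt N (a :: l) = N a + wt N l := by simp [wt]
    rw [this, ih]
    fin_cases a <;> simp [List.count_cons] <;> ring

/-- transposed action on weights -/
def TT (N : Fin 3 → ℤ) : Fin 3 → ℤ := fun a => wt N (famor a)

lemma TT0 (N : Fin 3 → ℤ) : TT N 0 = 5 * N 0 + 4 * N 1 + 2 * N 2 := by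
  simp [TT, wt, famor]; ring
lemma TT1 (N : Fin 3 → ℤ) : TT N 1 = 6 * N 0 + 5 * N 1 + 2 * N 2 := by
  simp [TT, wt, famor]; ring
lemma TT2 (N : Fin 3 → ℤ) : TT N 2 = 2 * N 0 + 2 * N 1 + N 2 := by
  simp [TT, wt, famor]; ring

lemma wt_applyM (N : Fin 3 → ℤ) (l : List (Fin 3)) : wt N (applyM famor l) = wt (TT N) l := by
  induction l with
  | nil => simp [wt, applyM]
  | cons a l ih =>
    have h1 : applyM famor (a :: l) = famor a ++ applyM famor l := by simp [applyM]
    have h2 : wt (TT N) (a :: l) = TT N a + wt (TT N) l := by simp [wt]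
    rw [h1, h2, wt_append, ih]; rfl

lemma wt_rec (N : Fin 3 → ℤ) (l : List (Fin 3)) :
    wt N (applyM famor (applyM famor (applyM famor l))) =
      11 * wt N (applyM famor (applyM famor l)) - 3 * wt N (applyM famor l) + wt N l := by
  simp only [wt_applyM]
  simp only [wt_count, TT0, TT1, TT2]
  ring

lemma bounded_zero (s : ℕ → ℤ)
    (hs : ∀ k, s (k+3) = 11 * s (k+2) - 3 * s (k+1) + s k) (B : ℕ) :
    ∀ j, (∀ k, j ≤ k → |s k| ≤ B) → ∃ j', ∀ k, j' ≤ k → s k = 0 := by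
  induction B with
  | zero =>
    intro j h
    exact ⟨j, fun k hk => by simpa using h k hk⟩
  | succ B ih =>
    intro j h
    refine ih (j+2) fun k hk => ?_
    obtain ⟨i, rfl⟩ : ∃ i, k = i + 2 := ⟨k - 2, by omega⟩
    have h0 := abs_le.1 (h i (by omega))
    have h1 := abs_le.1 (h (i+1) (by omega))
    have h3 := abs_le.1 (h (i+3) (by omega))
    have := hs i
    push_cast at *
    rw [abs_le]
    constructor <;> omega

lemma back_zero (s : ℕ → ℤ)
    (hs : ∀ k, s (k+3) = 11 * s (k+2) - 3 * s (k+1) + s k) (j : ℕ) :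
    (∀ k, j ≤ k → s k = 0) → ∀ k, s k = 0 := by
  induction j with
  | zero => intro h k; exact h k (Nat.zero_le _)
  | succ j ih =>
    intro h
    refine ih fun k hk => ?_
    have := hs k
    rw [h (k+1) (by omega), h (k+2) (by omega), h (k+3) (by omega)] at this
    omega

lemma wt_bound (N : Fin 3 → ℤ) (l : List (Fin 3)) :
    |wt N l| ≤ (|N 0| + |N 1| + |N 2|) * l.length := by
  induction l with
  | nil => simp [wt]
  | cons a l ih =>
    have : wt N (a :: l) = N a + wt N l := by simp [wt]
    rw [this]
    have h1 := abs_add_le (N a) (wt N l)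
    have h2 : |N a| ≤ |N 0| + |N 1| + |N 2| := by
      have := abs_nonneg (N 0)
      have := abs_nonneg (N 1)
      have := abs_nonneg (N 2)
      fin_cases a <;> simp <;> linarith
    push_cast [List.length_cons]
    linarith

lemma prefI_prefix {p q : List (Fin 3)} {x : ℕ → Fin 3} (hp : IsPrefixI p x)
    (hq : IsPrefixI q x) (h : p.length ≤ q.length) : p <+: q := by
  rw [List.prefix_iff_getElem]
  refine ⟨h, fun i hi => ?_⟩
  have h1 := hp i hi
  have h2 := hq i (by omega)
  simp only [List.get_eq_getElem] at h1 h2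
  rw [h1, h2]

lemma prefI_eq {p : List (Fin 3)} {x : ℕ → Fin 3} (hp : IsPrefixI p x) :
    p = infPrefix x p.length := by
  apply List.ext_getElem
  · simp [infPrefix]
  · intro i h1 h2
    have := hp i h1
    simpa [infPrefix] using this

lemma exists_orth (p q : Fin 3 → ℤ) : ∃ N : Fin 3 → ℤ, N ≠ 0 ∧
    p 0 * N 0 + p 1 * N 1 + p 2 * N 2 = 0 ∧ q 0 * N 0 + q 1 * N 1 + q 2 * N 2 = 0 := by
  have hd : (Matrix.of ![p, q, p]).det = 0 :=
    Matrix.det_zero_of_row_eq (i := 0) (j := 2) (by decide) rfl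
  obtain ⟨N, hN, h⟩ := Matrix.exists_mulVec_eq_zero_iff.2 hd
  refine ⟨N, hN, ?_, ?_⟩
  · have := congrFun h 0
    simpa [Matrix.mulVec, dotProduct, Fin.sum_univ_three] using this
  · have := congrFun h 1
    simpa [Matrix.mulVec, dotProduct, Fin.sum_univ_three] using this

/-- the fixed point `ξ_a` of `f_a` beginning with `a` cannot be
decomposed as an infinite concatenation of copies of two finite words. -/
theorem xi_not_two_word_decomposable (x : ℕ → Fin 3) (h0 : x 0 = 0)
    (hfix : InfImage famor x x) :
    ∀ u v : List (Fin 3), ¬ ∃ seq : ℕ → List (Fin 3),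
      (∀ n : ℕ, seq n = u ∨ seq n = v) ∧
      (∀ n : ℕ, IsPrefixI (((List.range n).map seq).flatten) x) ∧
      (∀ m : ℕ, ∃ n : ℕ, m ≤ (((List.range n).map seq).flatten).length) := by
  rintro u v ⟨seq, hseq, hpre, hlen⟩
  obtain ⟨N, hN, hu, hv⟩ := exists_orth (fun i => (u.count i : ℤ)) (fun i => (v.count i : ℤ))
  rw [← wt_count] at hu hv
  have hs0 : ∀ n, wt N (seq n) = 0 := fun n => by
    rcases hseq n with h | h <;> rw [h] <;> assumption
  have hF : ∀ n, ((List.range (n+1)).map seq).flatten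
      = ((List.range n).map seq).flatten ++ seq n := by
    intro n; simp [List.range_succ]
  have hF0 : ∀ n, wt N (((List.range n).map seq).flatten) = 0 := by
    intro n
    induction n with
    | zero => simp [wt]
    | succ n ih => rw [hF, wt_append, ih, hs0]; rfl
  set K : ℤ := |N 0| + |N 1| + |N 2| with hK
  have hK0 : 0 ≤ K := by positivity
  have hb : ∀ n p, p <+: ((List.range n).map seq).flatten →
      |wt N p| ≤ K * (u.length + v.length) := by
    intro n
    induction n with
    | zero =>
      intro p hp
      have : p = [] := by simpa using hp
      subst this
      simp only [wt, List.map_nil, List.sum_nil, abs_zero]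
      positivity
    | succ n ih =>
      intro p hp
      rw [hF] at hp
      rcases List.prefix_or_prefix_of_prefix hp (List.prefix_append _ _) with hp' | ⟨t, rfl⟩
      · exact ih p hp'
      · rw [wt_append, hF0, zero_add]
        refine (wt_bound N t).trans ?_
        refine mul_le_mul_of_nonneg_left ?_ hK0
        have := ((List.prefix_append_right_inj _).1 hp).length_le
        rcases hseq n with h | h <;> rw [h] at this <;> omega
  have hP : ∀ k, IsPrefixI ((applyM famor)^[k] [0]) x := by
    intro k
    induction k with
    | zero =>
      intro i hi
      have : i = 0 := by simpa using hi
      subst this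
      simp [h0]
    | succ k ih =>
      rw [Function.iterate_succ_apply', prefI_eq ih]
      exact hfix _
  let s : ℕ → ℤ := fun k => wt N ((applyM famor)^[k] [0])
  have hrec : ∀ k, s (k+3) = 11 * s (k+2) - 3 * s (k+1) + s k := by
    intro k
    simp only [s, Function.iterate_succ_apply']
    exact wt_rec N _
  have hbd : ∀ k, 0 ≤ k → |s k| ≤ ((K.toNat * (u.length + v.length) : ℕ) : ℤ) := by
    intro k _
    obtain ⟨n, hn⟩ := hlen ((applyM famor)^[k] [0]).length
    have := hb n _ (prefI_prefix (hP k) (hpre n) hn)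
    push_cast
    rw [Int.toNat_of_nonneg hK0]
    exact this
  obtain ⟨j, hj⟩ := bounded_zero s hrec _ 0 hbd
  have hz := back_zero s hrec j hj
  have e0 := hz 0
  have e1 := hz 1
  have e2 := hz 2
  simp only [s, Function.iterate_succ_apply', Function.iterate_zero, id, wt_applyM] at e0 e1 e2
  simp only [Function.iterate_succ_apply', Function.iterate_zero, id, wt, List.map_cons,
    List.map_nil, List.sum_cons, List.sum_nil, TT0, TT1, TT2, wt_applyM] at e0 e1 e2
  apply hN
  funext i
  fin_cases i <;> simp <;> omega
end

section
/- Let A be a finite alphabet with at least three letters. There exists no set S of nonerasing morphisms (between free monoids over subalphabets of A) such that the set of infinite LSP words over A is exactly the set of S-adic infinite words over A. -/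
section LSPProof

variable {A : Type*} {B : Type*} {C : Type*}

theorem infPrefix_length (w : ℕ → A) (n : ℕ) : (infPrefix w n).length = n := by
  simp [infPrefix]

theorem pfx_infPrefix (w : ℕ → A) (n : ℕ) : IsPrefixI (infPrefix w n) w := by
  intro i h; simp [infPrefix]

theorem pfx_mono {u u' : List A} {w : ℕ → A} (h : u <+: u') (hp : IsPrefixI u' w) :
    IsPrefixI u w := by
  obtain ⟨t, rfl⟩ := h
  intro i hi
  have := hp i (by simp; omega)
  simpa [List.getElem_append_left hi] using this

theorem pfx_comp {u u' : List A} {w : ℕ → A} (h : IsPrefixI u w) (h' : IsPrefixI u' w)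
    (hl : u.length ≤ u'.length) : u <+: u' := by
  rw [List.prefix_iff_eq_take]
  apply List.ext_getElem
  · simp [hl]
  · intro i h1 h2
    have a := h i h1
    have b := h' i (by omega)
    simp at a b
    simp [a, b]

theorem pfx_eq {u : List A} {w : ℕ → A} (h : IsPrefixI u w) : u = infPrefix w u.length := by
  have := pfx_comp h (pfx_infPrefix w u.length) (by simp [infPrefix_length])
  exact this.eq_of_length (by simp [infPrefix_length])

theorem infPrefix_succ (w : ℕ → A) (n : ℕ) : infPrefix w (n+1) = infPrefix w n ++ [w n] := by
  rw [infPrefix, List.ofFn_succ_last]; simp [infPrefix]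

theorem pfx_snoc {u : List A} {w : ℕ → A} (h : IsPrefixI u w) :
    IsPrefixI (u ++ [w u.length]) w := by
  have := pfx_infPrefix w (u.length+1)
  rwa [infPrefix_succ, ← pfx_eq h] at this

theorem pfx_last {u : List A} {a : A} {w : ℕ → A} (h : IsPrefixI (u ++ [a]) w) :
    a = w u.length := by
  have := h u.length (by simp)
  simpa using this

theorem pfx_head {u : List A} {a : A} {w : ℕ → A} (h : IsPrefixI (a :: u) w) :
    a = w 0 := by
  have := h 0 (by simp)
  simpa using this

theorem infPrefix_add (w : ℕ → A) (k n : ℕ) :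
    infPrefix w (k+n) = infPrefix w k ++ infPrefix (fun i => w (k+i)) n := by
  induction n with
  | zero => simp [infPrefix]
  | succ n ih => rw [← add_assoc, infPrefix_succ, ih, infPrefix_succ]; simp

theorem fac_iff {u : List A} {w : ℕ → A} : IsFactorI u w ↔ ∃ p, IsPrefixI (p ++ u) w := by
  constructor
  · rintro ⟨k, hk⟩
    have : u = infPrefix (fun i => w (k+i)) u.length := pfx_eq hk
    refine ⟨infPrefix w k, ?_⟩
    rw [this, ← infPrefix_add]
    exact pfx_infPrefix _ _
  · rintro ⟨p, hp⟩
    refine ⟨p.length, fun i hi => ?_⟩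
    have := hp (p.length + i) (by simp; omega)
    simpa using this

theorem fac_of_pfx {u : List A} {w : ℕ → A} (h : IsPrefixI u w) : IsFactorI u w :=
  fac_iff.2 ⟨[], h⟩

theorem fac_infix {u u' : List A} {w : ℕ → A} (h : u <:+: u') (hp : IsFactorI u' w) :
    IsFactorI u w := by
  obtain ⟨s, t, rfl⟩ := h
  obtain ⟨p, hp⟩ := fac_iff.1 hp
  refine fac_iff.2 ⟨p ++ s, pfx_mono ?_ hp⟩
  simp

theorem fac_extend {u : List A} {w : ℕ → A} (h : IsFactorI u w) :
    ∃ d, IsFactorI (u ++ [d]) w := by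
  obtain ⟨p, hp⟩ := fac_iff.1 h
  refine ⟨w (p ++ u).length, fac_iff.2 ⟨p, ?_⟩⟩
  rw [← List.append_assoc]; exact pfx_snoc hp

theorem applyM_append (f : A → List B) (u v : List A) :
    applyM f (u ++ v) = applyM f u ++ applyM f v := by simp [applyM]

theorem applyM_cons (f : A → List B) (a : A) (v : List A) :
    applyM f (a :: v) = f a ++ applyM f v := by simp [applyM]

theorem applyM_nil (f : A → List B) : applyM f [] = [] := by simp [applyM]

theorem applyM_single (f : A → List B) (a : A) : applyM f [a] = f a := by simp [applyM]

theorem applyM_comp (f : B → List C) (h : A → List B) (l : List A) :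
    applyM (fun t => applyM f (h t)) l = applyM f (applyM h l) := by
  induction l with
  | nil => simp [applyM]
  | cons a l ih => simp [applyM_cons, applyM_append, ih]

theorem applyM_prefix (f : A → List B) {u v : List A} (h : u <+: v) :
    applyM f u <+: applyM f v := by
  obtain ⟨t, rfl⟩ := h
  rw [applyM_append]; simp

theorem img_pfx {f : A → List B} {v : ℕ → A} {w : ℕ → B} (h : InfImage f v w) {p : List A}
    (hp : IsPrefixI p v) : IsPrefixI (applyM f p) w := by
  rw [pfx_eq hp]; exact h _

theorem img_fac {f : A → List B} {v : ℕ → A} {w : ℕ → B} (h : InfImage f v w) {p : List A}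
    (hp : IsFactorI p v) : IsFactorI (applyM f p) w := by
  obtain ⟨q, hq⟩ := fac_iff.1 hp
  refine fac_iff.2 ⟨applyM f q, ?_⟩
  rw [← applyM_append]; exact img_pfx h hq

theorem img_len {f : A → List B} {v : ℕ → A} (hf : ∀ y ∈ Set.range v, f y ≠ []) (n : ℕ) :
    n ≤ (applyM f (infPrefix v n)).length := by
  induction n with
  | zero => simp
  | succ n ih =>
    rw [infPrefix_succ, applyM_append, applyM_single, List.length_append]
    have := List.length_pos_iff.2 (hf (v n) ⟨n, rfl⟩)
    omega

theorem img_cover {f : A → List B} {v : ℕ → A} {w : ℕ → B}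
    (hf : ∀ y ∈ Set.range v, f y ≠ []) (h : InfImage f v w) {q : List B}
    (hq : IsPrefixI q w) : q <+: applyM f (infPrefix v q.length) :=
  pfx_comp hq (h _) (img_len hf _)

theorem infPrefix_prefix (v : ℕ → A) {m n : ℕ} (h : m ≤ n) : infPrefix v m <+: infPrefix v n :=
  pfx_comp (pfx_infPrefix v m) (pfx_infPrefix v n) (by simpa [infPrefix_length] using h)

theorem img_exists {f : A → List B} {v : ℕ → A} (hf : ∀ y ∈ Set.range v, f y ≠ []) :
    ∃ w, InfImage f v w := by
  have hl := img_len hf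
  refine ⟨fun i => (applyM f (infPrefix v (i+1)))[i]'(hl (i+1)), ?_⟩
  intro n i hi
  simp only [List.get_eq_getElem]
  rcases le_total n (i+1) with h | h
  · have := applyM_prefix f (infPrefix_prefix v h)
    exact this.getElem hi
  · have := applyM_prefix f (infPrefix_prefix v h)
    exact (this.getElem (hl (i+1))).symm

theorem img_comp {f : B → List C} {h : A → List B} {v : ℕ → A} {y : ℕ → B} {x : ℕ → C}
    (h1 : InfImage h v y) (h2 : InfImage f y x) :
    InfImage (fun t => applyM f (h t)) v x := by
  intro n
  rw [applyM_comp]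
  exact img_pfx h2 (h1 n)

theorem img_decomp {f : B → List C} {h : A → List B} {v : ℕ → A} {y : ℕ → B} {x : ℕ → C}
    (hh : ∀ y ∈ Set.range v, h y ≠ [])
    (h1 : InfImage h v y) (h2 : InfImage (fun t => applyM f (h t)) v x) :
    InfImage f y x := by
  intro n
  have := img_cover hh h1 (pfx_infPrefix y n)
  refine pfx_mono (applyM_prefix f this) ?_
  rw [← applyM_comp]
  exact h2 _

theorem word_ext {v w : ℕ → A} (h : ∀ n, IsPrefixI (infPrefix v n) w) : v = w := by
  funext i
  have := h (i+1)
  rw [infPrefix_succ] at this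
  simpa [infPrefix_length] using pfx_last this

structure TreeM (f : A → List A) (α : A) (p : A → A) : Prop where
  root : f α = [α]
  step : ∀ t, t ≠ α → f t = f (p t) ++ [t]
  head : ∀ t, ∃ tl, f t = α :: tl ∧ α ∉ tl

def decM [DecidableEq A] (α : A) : List A → List A
  | [] => []
  | [_] => []
  | s :: t :: l => if t = α then s :: decM α (t :: l) else decM α (t :: l)

theorem decM_append [DecidableEq A] (α : A) (l : List A) (e s : A) (r : List A) :
    decM α ((l ++ [e]) ++ (s :: r)) =
      decM α (l ++ [e]) ++ ((if s = α then [e] else []) ++ decM α (s :: r)) := by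
  induction l with
  | nil => by_cases h : s = α <;> simp [decM, h]
  | cons a l ih =>
    cases l with
    | nil => 
      by_cases h : e = α <;> by_cases h' : s = α <;> simp [decM, h, h']
    | cons b l =>
      by_cases h : b = α
      · simp only [List.cons_append, decM, h, if_true] at ih ⊢
        rw [ih]
      · simp only [List.cons_append, decM, h, if_false] at ih ⊢
        rw [ih]

theorem decM_snoc [DecidableEq A] (α : A) (l : List A) (e s : A) :
    decM α ((l ++ [e]) ++ [s]) = decM α (l ++ [e]) ++ (if s = α then [e] else []) := by
  rw [decM_append]; simp [decM]

theorem decM_free [DecidableEq A] (α : A) (s : A) (tl : List A) (h : α ∉ tl) :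
    decM α (s :: tl) = [] := by
  induction tl generalizing s with
  | nil => simp [decM]
  | cons a l ih =>
    simp at h
    rw [decM, if_neg (Ne.symm h.1), ih _ h.2]

theorem decM_prefix [DecidableEq A] (α : A) {q q' : List A} (h : q <+: q') :
    decM α q <+: decM α q' := by
  obtain ⟨s, rfl⟩ := h
  rcases List.eq_nil_or_concat' q with rfl | ⟨l, e, rfl⟩
  · simp [decM]
  · cases s with
    | nil => simp
    | cons a r => rw [decM_append]; simp

theorem decM_len [DecidableEq A] (α : A) (s : A) (q : List A) :
    (decM α (s :: q)).length ≤ q.length := by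
  induction q generalizing s with
  | nil => simp [decM]
  | cons a l ih =>
    rw [decM]
    have := ih a
    split_ifs <;> simp <;> omega

namespace TreeM

variable {f : A → List A} {α : A} {p : A → A}

theorem ne_nil (T : TreeM f α p) (t : A) : f t ≠ [] := by
  obtain ⟨tl, h, _⟩ := T.head t; simp [h]

theorem last (T : TreeM f α p) (t : A) : ∃ l, f t = l ++ [t] := by
  by_cases h : t = α
  · subst h; exact ⟨[], T.root⟩
  · exact ⟨_, T.step t h⟩

theorem applyM_head (T : TreeM f α p) (M : List A) : ∃ r, applyM f M ++ [α] = α :: r := by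
  cases M with
  | nil => exact ⟨[], by simp [applyM]⟩
  | cons a M =>
    obtain ⟨tl, h, _⟩ := T.head a
    exact ⟨tl ++ applyM f M ++ [α], by simp [applyM_cons, h]⟩

theorem chain_f (T : TreeM f α p) (t : A) : (f t).IsChain (fun s t => t = α ∨ s = p t) := by
  generalize hn : (f t).length = n
  induction n generalizing t with
  | zero => simp [List.length_eq_zero_iff.1 hn]
  | succ n ih =>
    by_cases h : t = α
    · subst h; rw [T.root]; simp
    · have := T.step t h
      rw [this] at hn ⊢
      simp at hn
      rw [List.isChain_append]
      refine ⟨ih _ hn, by simp, ?_⟩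
      obtain ⟨l, hl⟩ := T.last (p t)
      rw [hl]
      simp

theorem chain_applyM (T : TreeM f α p) (M : List A) :
    (applyM f M).IsChain (fun s t => t = α ∨ s = p t) := by
  induction M with
  | nil => simp [applyM]
  | cons a M ih =>
    rw [applyM_cons, List.isChain_append]
    refine ⟨T.chain_f a, ih, ?_⟩
    intro x hx y hy
    left
    cases M with
    | nil => simp [applyM] at hy
    | cons b M =>
      obtain ⟨tl, h, _⟩ := T.head b
      simp [applyM_cons, h] at hy
      exact hy.symm

theorem dec_img [DecidableEq A] (T : TreeM f α p) (M : List A) :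
    decM α (applyM f M ++ [α]) = M := by
  induction M with
  | nil => simp [applyM, decM]
  | cons a M ih =>
    obtain ⟨r, hr⟩ := T.applyM_head M
    obtain ⟨l, hl⟩ := T.last a
    obtain ⟨tl, h, h'⟩ := T.head a
    have h0 : decM α (f a) = [] := by rw [h]; exact decM_free _ _ _ h'
    rw [applyM_cons, List.append_assoc]
    rw [hr] at ih ⊢
    rw [hl, decM_append, ← hl, h0, ih]
    simp

theorem recon [DecidableEq A] (T : TreeM f α p) (l : List A) (e : A)
    (hc : (l ++ [e]).IsChain (fun s t => t = α ∨ s = p t)) (hh : (l ++ [e]).head? = some α) :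
    l ++ [e] = applyM f (decM α (l ++ [e]) ++ [e]) := by
  induction l using List.reverseRecOn generalizing e with
  | nil => simp at hh; subst hh; simp [decM, applyM, T.root]
  | append_singleton l s ih =>
    have hc' := hc
    rw [List.isChain_append] at hc
    have hs := hc.2.2 s (by simp) e (by simp)
    have i1 := ih s hc.1 (by simpa using hh)
    rw [decM_snoc]
    by_cases h : e = α
    · subst h
      simp only [if_true]
      rw [applyM_append, ← i1, applyM_single, T.root]
    · rcases hs with hs | hs
      · exact absurd hs h
      rw [if_neg h, List.append_nil, applyM_append, applyM_single, T.step e h, ← hs]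
      rw [applyM_append, applyM_single] at i1
      rw [← List.append_assoc, ← i1]

variable {v w : ℕ → A}

theorem chain_fac (T : TreeM f α p) (hI : InfImage f v w) {q : List A} (h : IsFactorI q w) :
    q.IsChain (fun s t => t = α ∨ s = p t) := by
  obtain ⟨r, hr⟩ := fac_iff.1 h
  have := img_cover (fun y _ => T.ne_nil y) hI hr
  obtain ⟨s, hs⟩ := this
  have hc := T.chain_applyM (infPrefix v (r ++ q).length)
  rw [← hs, List.isChain_append, List.isChain_append] at hc
  exact hc.1.2.1

theorem pred (T : TreeM f α p) (hI : InfImage f v w) {s t : A} (h : IsFactorI [s, t] w) :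
    t = α ∨ s = p t := by
  have := T.chain_fac hI h
  simpa using this

theorem zero (T : TreeM f α p) (hI : InfImage f v w) : w 0 = α := by
  have := img_pfx hI (pfx_infPrefix v 1)
  obtain ⟨tl, h, _⟩ := T.head (v 0)
  have e : infPrefix v 1 = [v 0] := by simp [infPrefix]
  rw [e, applyM_single, h] at this
  exact (pfx_head this).symm

theorem dec_pfx [DecidableEq A] (T : TreeM f α p) (hI : InfImage f v w) {q : List A}
    (h : IsPrefixI q w) : IsPrefixI (decM α q) v := by
  have := img_cover (fun y _ => T.ne_nil y) hI h
  have h2 := decM_prefix α (this.trans (List.prefix_append _ [α]))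
  rw [T.dec_img] at h2
  exact pfx_mono h2 (pfx_infPrefix _ _)

theorem dec_fac [DecidableEq A] (T : TreeM f α p) (hI : InfImage f v w) {e : A} {u : List A}
    (h : IsFactorI (e :: α :: u) w) : IsFactorI (e :: decM α (α :: u)) v := by
  obtain ⟨r, hr⟩ := fac_iff.1 h
  have := T.dec_pfx hI hr
  have e1 : r ++ e :: α :: u = (r ++ [e]) ++ (α :: u) := by simp
  rw [e1, decM_append] at this
  exact fac_iff.2 ⟨_, by simpa using this⟩

theorem next_pfx (T : TreeM f α p) (hI : InfImage f v w) {M : List A} (h : IsPrefixI M v) :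
    IsPrefixI (applyM f M ++ [α]) w := by
  have := img_pfx hI (pfx_snoc h)
  refine pfx_mono ?_ this
  obtain ⟨tl, h, _⟩ := T.head (v M.length)
  rw [applyM_append, applyM_single, h]
  simp

theorem inj (T : TreeM f α p) {v' : ℕ → A} (hI : InfImage f v w) (hI' : InfImage f v' w) :
    v = v' := by
  classical
  apply word_ext
  intro n
  have := T.dec_pfx hI' (T.next_pfx hI (pfx_infPrefix v n))
  rwa [T.dec_img] at this

theorem ext_fac [DecidableEq A] (T : TreeM f α p) (hI : InfImage f v w) {e t0 : A} {u u0 : List A}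
    (hu : α :: u = u0 ++ [t0])
    (h : IsFactorI (e :: α :: u) w) :
    α :: u = applyM f (decM α (α :: u)) ++ f t0 ∧
      ∃ t, f t0 <+: f t ∧ IsFactorI (e :: (decM α (α :: u) ++ [t])) v := by
  have hc := T.chain_fac hI h
  have hc2 : (α :: u).IsChain (fun s t => t = α ∨ s = p t) := by
    have := List.isChain_append.1 (show ([e] ++ α :: u).IsChain _ from hc)
    exact this.2.1
  have h1 : α :: u = applyM f (decM α (α :: u)) ++ f t0 := by
    have := T.recon u0 t0 (by rw [← hu]; exact hc2) (by rw [← hu]; simp)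
    rw [← hu, applyM_append, applyM_single] at this
    exact this
  refine ⟨h1, ?_⟩
  obtain ⟨r, hr⟩ := fac_iff.1 h
  have hd := T.dec_pfx hI hr
  have hcov := img_cover (fun y _ => T.ne_nil y) hI hr
  have hd2 := decM_prefix α (hcov.trans (List.prefix_append _ [α]))
  rw [T.dec_img] at hd2
  have e1 : r ++ e :: α :: u = (r ++ [e]) ++ (α :: u) := by simp
  generalize hM : infPrefix v (r ++ e :: α :: u).length = M at *
  have hMv : IsPrefixI M v := by rw [← hM]; exact pfx_infPrefix _ _
  rw [e1] at hcov hd2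
  rw [decM_append] at hd2
  have hr2 : r ++ [e] = applyM f (decM α (r ++ [e]) ++ [e]) := by
    apply T.recon
    · have hr' : IsPrefixI (r ++ [e]) w := pfx_mono ⟨α :: u, by simp⟩ hr
      exact T.chain_fac hI (fac_of_pfx hr')
    · have hr' : IsPrefixI (r ++ [e]) w := pfx_mono ⟨α :: u, by simp⟩ hr
      rw [← T.zero hI]
      cases hre : r ++ [e] with
      | nil => simp at hre
      | cons a l => rw [hre] at hr'; simp [pfx_head hr']
  obtain ⟨M3, hM3⟩ := hd2
  simp only [if_true] at hM3
  rw [← hM3] at hcov hMv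
  generalize decM α (r ++ [e]) = D at hr2 hcov hMv
  have hcov2 : f t0 <+: applyM f M3 := by
    rw [hr2] at hcov
    conv at hcov => lhs; rw [h1]
    simpa [applyM_append, applyM_single, applyM_cons, List.append_assoc, applyM_nil] using hcov
  cases M3 with
  | nil =>
    exfalso
    rw [applyM_nil] at hcov2
    exact T.ne_nil t0 (List.prefix_nil.1 hcov2)
  | cons t M4 =>
    refine ⟨t, ?_, ?_⟩
    · rw [applyM_cons] at hcov2
      rcases List.prefix_or_prefix_of_prefix hcov2 (List.prefix_append (f t) (applyM f M4)) with h | h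
      · exact h
      · obtain ⟨s, hs⟩ := h
        cases s with
        | nil => simp at hs; rw [hs]
        | cons a s =>
          exfalso
          rw [← hs] at hcov2
          rw [List.prefix_append_right_inj] at hcov2
          have ha : a = α := by
            cases M4 with
            | nil => simp [applyM_nil] at hcov2
            | cons b M5 =>
              obtain ⟨tl, h, _⟩ := T.head b
              rw [applyM_cons, h] at hcov2
              simp at hcov2
              exact hcov2.1
          obtain ⟨tl, h, h'⟩ := T.head t
          obtain ⟨tl0, h0, h0'⟩ := T.head t0
          rw [h, h0] at hs
          simp at hs
          apply h0'
          rw [← hs, ha]; simp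
    · refine fac_iff.2 ⟨D, pfx_mono ?_ hMv⟩
      exact ⟨M4, by simp⟩

end TreeM

def SP (u : List A) (w : ℕ → A) : Prop :=
  ∀ y z z' e e', IsPrefixI (u ++ [y]) w → IsFactorI (e :: (u ++ [z])) w →
    IsFactorI (e' :: (u ++ [z'])) w → z ≠ y → z' ≠ y → e = e'

theorem lsp_of_SP {w : ℕ → A} (h : ∀ u, SP u w) : IsLSP w := by
  rintro u ⟨e, e', hne, h1, h2⟩
  induction u using List.reverseRecOn with
  | nil => intro i hi; simp at hi
  | append_singleton u z ih =>
    have hu : IsPrefixI u w :=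
      ih (fac_infix ⟨[], [z], by simp⟩ h1) (fac_infix ⟨[], [z], by simp⟩ h2)
    have hs := pfx_snoc hu
    by_cases hz : z = w u.length
    · rw [hz]; exact hs
    · exact absurd (h u _ z z e e' hs h1 h2 hz hz) hne

theorem TreeM.lsp [DecidableEq A] {f : A → List A} {α : A} {p : A → A} (T : TreeM f α p)
    {v w : ℕ → A} (hI : InfImage f v w) (hv : ∀ u, SP u v) : IsLSP w := by
  rintro u ⟨e, e', hne, h1, h2⟩
  cases u with
  | nil => intro i hi; simp at hi
  | cons s u =>
    have hs : s = α := by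
      by_contra hs
      have a1 := T.pred hI (fac_infix (u := [e, s]) ⟨[], u, by simp⟩ h1)
      have a2 := T.pred hI (fac_infix (u := [e', s]) ⟨[], u, by simp⟩ h2)
      simp [hs] at a1 a2
      exact hne (a1.trans a2.symm)
    subst hs
    obtain ⟨u0, t0, hu⟩ : ∃ u0 t0, s :: u = u0 ++ [t0] := by
      rcases List.eq_nil_or_concat' (s :: u) with h | h
      · simp at h
      · exact h
    obtain ⟨hr, t, ht, hf⟩ := T.ext_fac hI hu h1
    obtain ⟨-, t', ht', hf'⟩ := T.ext_fac hI hu h2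
    generalize decM s (s :: u) = m at *
    have hm : IsPrefixI m v := lsp_of_SP hv m
      ⟨e, e', hne, fac_infix ⟨[], [t], by simp⟩ hf, fac_infix ⟨[], [t'], by simp⟩ hf'⟩
    have hm2 := pfx_snoc hm
    have key : ∀ t, f t0 <+: f t → t = v m.length → IsPrefixI (s :: u) w := by
      intro t ht h
      rw [← h] at hm2
      have := img_pfx hI hm2
      rw [applyM_append, applyM_single] at this
      rw [hr]
      refine pfx_mono ?_ this
      rw [List.prefix_append_right_inj]; exact ht
    by_cases h : t = v m.length
    · exact key t ht h
    by_cases h' : t' = v m.length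
    · exact key t' ht' h'
    exact absurd (hv m _ t t' e e' hm2 hf hf' h h') hne

def Fmor [DecidableEq A] (α b c : A) : A → List A :=
  fun t => if t = α then [α] else if t = c then [α, b, c] else [α, t]

theorem tree_L [DecidableEq A] (x : A) : TreeM (Lmor x) x (fun _ => x) where
  root := by simp [Lmor]
  step := by intro t h; simp [Lmor, h]
  head := by
    intro t
    by_cases h : t = x
    · exact ⟨[], by simp [Lmor, h]⟩
    · exact ⟨[t], by simp [Lmor, h, Ne.symm h]⟩

theorem tree_F [DecidableEq A] {α b c : A} (h1 : b ≠ α) (h2 : c ≠ α) (h3 : b ≠ c) :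
    TreeM (Fmor α b c) α (fun t => if t = c then b else α) where
  root := by simp [Fmor]
  step := by
    intro t h
    by_cases h' : t = c
    · subst h'; simp [Fmor, h, h1, h3]
    · simp [Fmor, h, h']
  head := by
    intro t
    by_cases h : t = α
    · exact ⟨[], by simp [Fmor, h]⟩
    · by_cases h' : t = c
      · exact ⟨[b, c], by simp [Fmor, h', h2, h1.symm, h2.symm]⟩
      · exact ⟨[t], by simp [Fmor, h, h', Ne.symm h]⟩

theorem SP_L [DecidableEq A] {x : A} {v w : ℕ → A} (hI : InfImage (Lmor x) v w) (u : List A)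
    (hv : ∀ m : List A, m.length < u.length → SP m v) : SP u w := by
  intro y z z' e e' hp h1 h2 hz hz'
  have T := tree_L x
  by_contra hne
  cases u with
  | nil =>
    have hy : y = x := by rw [← T.zero hI]; exact pfx_head hp
    subst hy
    have a1 := T.pred hI h1
    have a2 := T.pred hI h2
    simp [hz, hz'] at a1 a2
    exact hne (a1.trans a2.symm)
  | cons s u =>
    have hs : s = x := by
      by_contra hs
      have a1 := T.pred hI (fac_infix (u := [e, s]) ⟨[], u ++ [z], by simp⟩ h1)
      have a2 := T.pred hI (fac_infix (u := [e', s]) ⟨[], u ++ [z'], by simp⟩ h2)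
      simp [hs] at a1 a2
      exact hne (a1.trans a2.symm)
    subst hs
    obtain ⟨u0, l, hu⟩ : ∃ u0 t0, s :: u = u0 ++ [t0] := by
      rcases List.eq_nil_or_concat' (s :: u) with h | h
      · simp at h
      · exact h
    have hl : l = s := by
      by_contra hl
      have a1 := T.pred hI (fac_infix (u := [l, z]) ⟨e :: u0, [], by simp [hu]⟩ h1)
      have a2 := T.pred hI (fac_infix (u := [l, y]) ⟨u0, [], by simp [hu]⟩ (fac_of_pfx hp))
      simp [hl] at a1 a2
      exact hz (a1.trans a2.symm)
    subst hl
    -- decoding of u ++ [z, d]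
    have key : ∀ z d, IsFactorI [z, d] w →
        decM l (l :: u) ++ [z] <+: decM l (l :: u ++ [z] ++ [d]) := by
      intro z d hzd
      rw [decM_snoc, hu, decM_snoc]
      have := T.pred hI hzd
      by_cases h : z = l
      · simp [h]
      · simp [h] at this
        simp [h, this]
    have fk : ∀ e z, IsFactorI (e :: (l :: u ++ [z])) w → IsFactorI (e :: (decM l (l :: u) ++ [z])) v := by
      intro e z h
      obtain ⟨d, hd⟩ := fac_extend h
      have k := key z d (fac_infix ⟨e :: l :: u, [], by simp⟩ hd)
      have := T.dec_fac hI (e := e) (u := u ++ [z] ++ [d]) (by simpa using hd)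
      refine fac_infix ?_ this
      obtain ⟨r, hr⟩ := k
      refine ⟨[], r, ?_⟩
      simp only [List.cons_append] at hr
      simp only [List.nil_append, List.cons_append, hr]
    have hp' : IsPrefixI (decM l (l :: u) ++ [y]) v := by
      have hd := pfx_snoc hp
      have k := key y (w (l :: u ++ [y]).length) (fac_infix ⟨l :: u, [], by simp⟩ (fac_of_pfx hd))
      exact pfx_mono k (T.dec_pfx hI hd)
    have hlen := decM_len l l u
    exact hne (hv _ (by simp; omega) y z z' e e' hp' (fk e z h1) (fk e' z' h2) hz hz')

theorem SP_chain [DecidableEq A] {x : ℕ → A} {W : ℕ → ℕ → A}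
    (hW : ∀ n, InfImage (Lmor (x n)) (W (n+1)) (W n)) (u : List A) (n : ℕ) : SP u (W n) := by
  generalize hk : u.length = k
  induction k using Nat.strong_induction_on generalizing u n with
  | _ k ih =>
    refine SP_L (hW n) u ?_
    intro m hm
    exact ih _ (hk ▸ hm) m (n+1) rfl

def preW [DecidableEq A] (x : ℕ → A) : ℕ → ℕ → List A
  | 0, _ => []
  | i+1, n => (applyM (Lmor (x n)) (preW x i (n+1)) ++ [x n]).take (i+1)

theorem preW_len [DecidableEq A] (x : ℕ → A) (i n : ℕ) : (preW x i n).length = i := by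
  induction i generalizing n with
  | zero => simp [preW]
  | succ i ih =>
    rw [preW, List.length_take, List.length_append]
    have : ∀ l : List A, l.length ≤ (applyM (Lmor (x n)) l).length := by
      intro l
      induction l with
      | nil => simp
      | cons a l ih =>
        rw [applyM_cons, List.length_append, List.length_cons]
        have := List.length_pos_iff.2 ((tree_L (x n)).ne_nil a)
        omega
    have h := this (preW x i (n+1))
    rw [ih] at h
    simp; omega

theorem preW_step [DecidableEq A] {u u' : List A} (y : A) (h : u <+: u') :
    applyM (Lmor y) u ++ [y] <+: applyM (Lmor y) u' ++ [y] := by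
  obtain ⟨t, rfl⟩ := h
  rw [applyM_append, List.append_assoc, List.prefix_append_right_inj]
  obtain ⟨r, hr⟩ := (tree_L y).applyM_head t
  rw [hr]; simp

theorem preW_succ [DecidableEq A] (x : ℕ → A) (i n : ℕ) : preW x i n <+: preW x (i+1) n := by
  induction i generalizing n with
  | zero => simp [preW]
  | succ i ih =>
    rw [preW]
    have h1 := preW_step (x n) (ih (n+1))
    have h2 : List.take (i+1) (applyM (Lmor (x n)) (preW x i (n+1)) ++ [x n]) <+:
      applyM (Lmor (x n)) (preW x (i+1) (n+1)) ++ [x n] := (List.take_prefix _ _).trans h1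
    conv_rhs => rw [preW]
    refine List.prefix_of_prefix_length_le h2 (List.take_prefix _ _) ?_
    have a := preW_len x (i+1) n
    have b := preW_len x (i+1+1) n
    rw [preW] at a b
    rw [a, b]; omega

theorem preW_mono [DecidableEq A] (x : ℕ → A) {i j : ℕ} (h : i ≤ j) (n : ℕ) :
    preW x i n <+: preW x j n := by
  induction j, h using Nat.le_induction with
  | base => exact List.prefix_refl _
  | succ j _ ih => exact ih.trans (preW_succ x j n)

theorem W_exists [DecidableEq A] (x : ℕ → A) :
    ∃ W : ℕ → ℕ → A, ∀ n, InfImage (Lmor (x n)) (W (n+1)) (W n) := by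
  let W : ℕ → ℕ → A := fun n i => (preW x (i+1) n)[i]'(by rw [preW_len]; omega)
  have hp : ∀ n i, IsPrefixI (preW x i n) (W n) := by
    intro n i j hj
    have hj' := hj
    rw [preW_len] at hj'
    exact ((preW_mono x (show j+1 ≤ i by omega) n).getElem (by rw [preW_len]; omega)).symm
  refine ⟨W, fun n => ?_⟩
  have hpe : ∀ i, infPrefix (W (n+1)) i = preW x i (n+1) := by
    intro i
    have := pfx_eq (hp (n+1) i)
    rw [preW_len] at this
    exact this.symm
  intro i
  rw [hpe]
  -- compare with a long prefix
  set q := applyM (Lmor (x n)) (preW x i (n+1)) with hq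
  set k := max q.length i with hk
  have h1 : q <+: applyM (Lmor (x n)) (preW x k (n+1)) ++ [x n] :=
    (applyM_prefix _ (preW_mono x (le_max_right _ _) (n+1))).trans (List.prefix_append _ _)
  have h2 := hp n (k+1)
  refine pfx_mono ?_ h2
  rw [preW, List.prefix_take_iff]
  exact ⟨h1, by omega⟩

namespace TreeM

variable {f : A → List A} {α : A} {p : A → A} {v w : ℕ → A}

theorem push (T : TreeM f α p) (hI : InfImage f v w) {β : A} {M : List A}
    (h : IsFactorI (β :: M) v) : IsFactorI (β :: (applyM f M ++ [α])) w := by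
  obtain ⟨d, hd⟩ := fac_extend h
  have := img_fac hI hd
  obtain ⟨l, hl⟩ := T.last β
  obtain ⟨tl, ht, _⟩ := T.head d
  rw [List.cons_append, applyM_cons, applyM_append, applyM_single, hl, ht] at this
  exact fac_infix ⟨l, tl, by simp⟩ this

theorem lsp_back (T : TreeM f α p) (hI : InfImage f v w) (hw : IsLSP w) : IsLSP v := by
  classical
  rintro u ⟨e, e', hne, h1, h2⟩
  have := hw _ ⟨e, e', hne, T.push hI h1, T.push hI h2⟩
  have := T.dec_pfx hI this
  rwa [T.dec_img] at this

end TreeM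

theorem frag_L [DecidableEq A] {x a b c : A} {v w : ℕ → A} (hI : InfImage (Lmor x) v w)
    (h : Fragile v a b c) : Fragile w a b c := by
  obtain ⟨u, β, γ, hne, hp, h1, h2⟩ := h
  have T := tree_L x
  have key : ∀ a, applyM (Lmor x) u ++ [x] ++ [a] <+: applyM (Lmor x) (u ++ [a]) ++ [x] := by
    intro a
    rw [applyM_append, applyM_single]
    by_cases h : a = x <;> simp [Lmor, h]
  refine ⟨applyM (Lmor x) u ++ [x], β, γ, hne, pfx_mono (key a) (T.next_pfx hI hp), ?_, ?_⟩
  · obtain ⟨r, hr⟩ := key b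
    exact fac_infix ⟨[], r, by rw [← hr]; simp⟩ (T.push hI h1)
  · obtain ⟨r, hr⟩ := key c
    exact fac_infix ⟨[], r, by rw [← hr]; simp⟩ (T.push hI h2)

theorem frag_F [DecidableEq A] {α b c : A} (hb : b ≠ α) (hc : c ≠ α) (hbc : b ≠ c)
    {v w : ℕ → A} (hI : InfImage (Fmor α b c) v w)
    (h : Fragile v α b c) : ¬ IsLSP w := by
  obtain ⟨u, β, γ, hne, hp, h1, h2⟩ := h
  have T := tree_F hb hc hbc
  intro hw
  have a1 : IsPrefixI (applyM (Fmor α b c) u ++ [α] ++ [α]) w := by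
    have := T.next_pfx hI hp
    rwa [applyM_append, applyM_single, T.root] at this
  have a2 := T.push hI h1
  have a3 := T.push hI h2
  rw [applyM_append, applyM_single] at a2 a3
  have := hw (applyM (Fmor α b c) u ++ [α] ++ [b]) ⟨β, γ, hne,
    fac_infix ⟨[], [α], by simp [Fmor, hb, hbc]⟩ a2,
    fac_infix ⟨[], [c, α], by simp [Fmor, hc]⟩ a3⟩
  exact hb ((pfx_last this).trans (pfx_last a1).symm)

def cyc (l : List A) (hl : l ≠ []) : ℕ → A :=
  fun i => l[i % l.length]'(Nat.mod_lt _ (List.length_pos_iff.2 hl))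

theorem cyc_pfx (l : List A) (hl : l ≠ []) : IsPrefixI l (cyc l hl) := by
  intro i hi
  simp [cyc, Nat.mod_eq_of_lt hi]

theorem cyc_lsp (l : List A) (hl : l ≠ []) (hn : l.Nodup) : IsLSP (cyc l hl) := by
  rintro u ⟨a, b, hab, ⟨i, hi⟩, ⟨j, hj⟩⟩
  cases u with
  | nil => intro i hi; simp at hi
  | cons s u =>
    exfalso
    apply hab
    have i0 := hi 0 (by simp)
    have i1 := hi 1 (by simp)
    have j0 := hj 0 (by simp)
    have j1 := hj 1 (by simp)
    simp [cyc] at i0 i1 j0 j1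
    have : (i+1) % l.length = (j+1) % l.length := by
      have := i1.symm.trans j1
      exact (List.Nodup.getElem_inj_iff hn).1 this
    have h2 : i % l.length = j % l.length := Nat.ModEq.add_right_cancel' 1 this
    rw [i0, j0]
    simp only [h2]

def xxy (x y : A) : ℕ → A := fun i => if i % 3 = 2 then y else x

theorem xxy_lsp (x y : A) : IsLSP (xxy x y) := by
  rintro u ⟨a, b, hab, ⟨i, hi⟩, ⟨j, hj⟩⟩
  have aux : ∀ i j : ℕ, i % 3 = 2 → j % 3 ≠ 2 → x ≠ y → 
      (∀ (k : ℕ) (h : k < u.length), u[k] = xxy x y (i + 1 + k)) →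
      (∀ (k : ℕ) (h : k < u.length), u[k] = xxy x y (j + 1 + k)) → IsPrefixI u (xxy x y) := by
    intro i j h1 h2 hxy hi hj k hk
    have e0 : ∀ k, (i + 1 + k) % 3 = k % 3 := by intro k; omega
    rw [List.get_eq_getElem, hi k hk]
    simp [xxy, e0]
  have hi' : ∀ (k : ℕ) (h : k < u.length), u[k] = xxy x y (i + 1 + k) := by
    intro k hk
    have := hi (k+1) (by simpa using hk)
    simp at this
    rw [this]; congr 1; ring
  have hj' : ∀ (k : ℕ) (h : k < u.length), u[k] = xxy x y (j + 1 + k) := by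
    intro k hk
    have := hj (k+1) (by simpa using hk)
    simp at this
    rw [this]; congr 1; ring
  have i0 := hi 0 (by simp)
  have j0 := hj 0 (by simp)
  simp [xxy] at i0 j0
  have hxy : x ≠ y := by
    rintro rfl
    simp at i0 j0
    exact hab (i0.trans j0.symm)
  by_cases h1 : i % 3 = 2 <;> by_cases h2 : j % 3 = 2
  · simp [h1, h2] at i0 j0; exact absurd (i0.trans j0.symm) hab
  · exact aux i j h1 h2 hxy hi' hj'
  · exact aux j i h2 h1 hxy hj' hi'
  · simp [h1, h2] at i0 j0; exact absurd (i0.trans j0.symm) hab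

theorem list_diff (U V : List A) (hl : U.length = V.length) (hne : U ≠ V) :
    ∃ (U' V' : List A) (a b : A) (s : List A), a ≠ b ∧ U = U' ++ a :: s ∧ V = V' ++ b :: s := by
  induction U using List.reverseRecOn generalizing V with
  | nil => simp at hl; exact absurd (List.length_eq_zero_iff.1 hl.symm).symm hne
  | append_singleton U a ih =>
    rcases List.eq_nil_or_concat' V with rfl | ⟨V, b, rfl⟩
    · simp at hl
    · by_cases hab : a = b
      · subst hab
        obtain ⟨U', V', c, d, s, h, h1, h2⟩ := ih V (by simpa using hl) (by simpa using hne)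
        exact ⟨U', V', c, d, s ++ [a], h, by simp [h1], by simp [h2]⟩
      · exact ⟨U, V, a, b, [], hab, rfl, rfl⟩

theorem pred_unique {W : ℕ → A} (hW : IsLSP W) {e e' b : A} (h1 : IsFactorI [e, b] W)
    (h2 : IsFactorI [e', b] W) (hb : b ≠ W 0) : e = e' := by
  by_contra hne
  exact hb (pfx_head (hW [b] ⟨e, e', hne, h1, h2⟩))

section core

variable [Fintype A] {g : A → List A} {F La : A → A}

theorem core_test (hg : ∀ t, g t ≠ [])
    (hT : ∀ v, IsLSP v → ∀ x, InfImage g v x → IsLSP x)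
    (hF : ∀ t, ∃ r, g t = F t :: r)
    {x : A} {l1 : List A} (hn : (x :: l1).Nodup) {b e e' : A} (hb : b ≠ F x)
    (h1 : [e, b] <:+: applyM g (x :: l1) ∨ ∃ t, [e, b] <:+: g t)
    (h2 : [e', b] <:+: applyM g (x :: l1) ∨ ∃ t, [e', b] <:+: g t) : e = e' := by
  classical
  set l := x :: l1 ++ (Finset.univ.filter (fun t => t ∉ x :: l1)).toList with hl
  have hne : l ≠ [] := by simp [hl]
  have hnd : l.Nodup := by
    rw [hl, List.nodup_append']
    refine ⟨hn, Finset.nodup_toList _, ?_⟩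
    intro t h1 h2
    simp only [Finset.mem_toList, Finset.mem_filter] at h2
    exact h2.2 h1
  have hall : ∀ t, t ∈ l := by
    intro t
    by_cases h : t ∈ x :: l1
    · rw [hl]; exact List.mem_append_left _ h
    · rw [hl]; apply List.mem_append_right
      simp only [Finset.mem_toList, Finset.mem_filter]
      exact ⟨Finset.mem_univ _, h⟩
  obtain ⟨W, hW⟩ := img_exists (f := g) (v := cyc l hne) (fun y _ => hg y)
  have hlsp := hT _ (cyc_lsp l hne hnd) W hW
  have hpre : IsPrefixI (applyM g l) W := img_pfx hW (cyc_pfx l hne)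
  have hp1 : IsPrefixI (applyM g (x :: l1)) W :=
    pfx_mono (applyM_prefix g (by rw [hl]; exact List.prefix_append _ _)) hpre
  have hfac : ∀ t, IsFactorI (g t) W := by
    intro t
    obtain ⟨s, r, hsr⟩ := List.append_of_mem (hall t)
    rw [hsr, applyM_append, applyM_cons] at hpre
    exact fac_infix ⟨applyM g s, applyM g r, by simp⟩ (fac_of_pfx hpre)
  have h0 : F x = W 0 := by
    obtain ⟨r, hr⟩ := hF x
    rw [applyM_cons, hr] at hp1
    exact pfx_head hp1
  have cv : ∀ e, ([e, b] <:+: applyM g (x :: l1) ∨ ∃ t, [e, b] <:+: g t) → IsFactorI [e, b] W := by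
    rintro e (h | ⟨t, h⟩)
    · exact fac_infix h (fac_of_pfx hp1)
    · exact fac_infix h (hfac t)
  exact pred_unique hlsp (cv e h1) (cv e' h2) (h0 ▸ hb)

theorem adj_infix (hF : ∀ t, ∃ r, g t = F t :: r) (hL : ∀ t, ∃ r, g t = r ++ [La t])
    (l r : List A) (s t : A) : [La s, F t] <:+: applyM g (l ++ s :: t :: r) := by
  obtain ⟨a, ha⟩ := hF t
  obtain ⟨b, hb⟩ := hL s
  rw [applyM_append, applyM_cons, applyM_cons, ha, hb]
  exact ⟨applyM g l ++ b, a ++ applyM g r, by simp⟩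

theorem core_two (hg : ∀ t, g t ≠ [])
    (hT : ∀ v, IsLSP v → ∀ x, InfImage g v x → IsLSP x)
    (hF : ∀ t, ∃ r, g t = F t :: r) {x y : A} {a b c : A} (hab : a ≠ b)
    (h1 : [a, c] <:+: g x ++ g y) (h2 : [b, c] <:+: g y ++ g x) : c = F x := by
  obtain ⟨W, hW⟩ := img_exists (f := g) (v := xxy x y) (fun y _ => hg y)
  have hlsp := hT _ (xxy_lsp x y) W hW
  have k := img_pfx hW (pfx_infPrefix _ 4)
  have e4 : infPrefix (xxy x y) 4 = [x, x, y, x] := by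
    simp [infPrefix, xxy, List.ofFn_succ]
  rw [e4] at k
  simp only [applyM_cons, applyM_nil, List.append_nil] at k
  have f1 : IsFactorI (g x ++ g y) W := fac_infix ⟨g x, g x, by simp⟩ (fac_of_pfx k)
  have f2 : IsFactorI (g y ++ g x) W := fac_infix ⟨g x ++ g x, [], by simp⟩ (fac_of_pfx k)
  have h0 : F x = W 0 := by
    obtain ⟨r, hr⟩ := hF x
    rw [hr] at k
    exact pfx_head k
  by_contra hc
  exact hab (pred_unique hlsp (fac_infix h1 f1) (fac_infix h2 f2) (h0 ▸ hc))

theorem core_lemma1 (hg : ∀ t, g t ≠ [])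
    (hT : ∀ v, IsLSP v → ∀ x, InfImage g v x → IsLSP x)
    (hF : ∀ t, ∃ r, g t = F t :: r) (hL : ∀ t, ∃ r, g t = r ++ [La t])
    (hnc : ∀ x y, x ≠ y → g x ++ g y ≠ g y ++ g x) {x y : A} (h : F x ≠ F y) : La x ≠ La y := by
  intro hla
  have hxy : x ≠ y := by rintro rfl; exact h rfl
  obtain ⟨U, V, a, b, s, hab, hU, hV⟩ := list_diff (g x ++ g y) (g y ++ g x)
    (by simp; omega) (hnc x y hxy)
  have hs : s ≠ [] := by
    rintro rfl
    obtain ⟨r, hr⟩ := hL x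
    obtain ⟨r', hr'⟩ := hL y
    have e1 : La y = a := by
      have := congrArg List.getLast? hU
      rw [hr'] at this
      simpa using this
    have e2 : La x = b := by
      have := congrArg List.getLast? hV
      rw [hr] at this
      simpa using this
    exact hab (e1.symm.trans (hla.symm.trans e2))
  obtain ⟨c, s', rfl⟩ := List.exists_cons_of_ne_nil hs
  have i1 : [a, c] <:+: g x ++ g y := ⟨U, s', by rw [hU]; simp⟩
  have i2 : [b, c] <:+: g y ++ g x := ⟨V, s', by rw [hV]; simp⟩
  exact h ((core_two hg hT hF hab i1 i2).symm.trans (core_two hg hT hF hab.symm i2 i1))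

theorem core_lemma2 (hcard : 3 ≤ Fintype.card A) (hg : ∀ t, g t ≠ [])
    (hT : ∀ v, IsLSP v → ∀ x, InfImage g v x → IsLSP x)
    (hF : ∀ t, ∃ r, g t = F t :: r) (hL : ∀ t, ∃ r, g t = r ++ [La t])
    (hnc : ∀ x y, x ≠ y → g x ++ g y ≠ g y ++ g x)
    (hns : ∀ b, ∃ x, F x ≠ b) {y z b e' : A} (hy : F y = b) (hz : [e', b] <:+: g z) : False := by
  classical
  have L1 : ∀ {x y}, F x ≠ F y → La x ≠ La y := core_lemma1 hg hT hF hL hnc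
  obtain ⟨x, hx⟩ := hns b
  have hxy : x ≠ y := by rintro rfl; exact hx hy
  have hlast : ∀ t, t ≠ y → La t = e' := by
    intro t ht
    by_cases htx : t = x
    · subst htx
      refine core_test hg hT hF (x := t) (l1 := [y]) (by simp [hxy]) hx.symm (Or.inl ?_) (Or.inr ⟨z, hz⟩)
      rw [← hy]
      exact adj_infix hF hL [] [] t y
    · refine core_test hg hT hF (x := x) (l1 := [t, y]) (by simp [hxy, ht, Ne.symm htx]) hx.symm
        (Or.inl ?_) (Or.inr ⟨z, hz⟩)
      rw [← hy]
      exact adj_infix hF hL [x] [] t y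
  obtain ⟨t, ht⟩ : ∃ t, t ∉ ({x, y} : Finset A) := by
    by_contra hcon
    push Not at hcon
    have : (Finset.univ : Finset A) ⊆ {x, y} := fun t _ => hcon t
    have := Finset.card_le_card this
    have h2 : ({x, y} : Finset A).card ≤ 2 := Finset.card_le_two
    rw [Finset.card_univ] at this
    omega
  simp at ht
  have hxt : F t = F x := by
    by_contra hh
    exact L1 hh ((hlast t ht.2).trans (hlast x hxy).symm)
  have := core_test hg hT hF (x := y) (l1 := [t, x]) (b := F x) (e := La y) (e' := La t)
    (by simp [ht.1, Ne.symm hxy, Ne.symm ht.2]) (by rw [hy]; exact hx)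
    (Or.inl (by rw [← hxt]; exact adj_infix hF hL [] [x] y t))
    (Or.inl (adj_infix hF hL [y] [] t x))
  have h2 : La x ≠ La y := L1 (by rw [hy]; exact hx)
  apply h2
  rw [this, hlast t ht.2, hlast x hxy]

theorem core_lemma3 (hcard : 3 ≤ Fintype.card A) (hg : ∀ t, g t ≠ [])
    (hT : ∀ v, IsLSP v → ∀ x, InfImage g v x → IsLSP x)
    (hF : ∀ t, ∃ r, g t = F t :: r) (hL : ∀ t, ∃ r, g t = r ++ [La t])
    (hnc : ∀ x y, x ≠ y → g x ++ g y ≠ g y ++ g x)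
    (hns : ∀ b, ∃ x, F x ≠ b) (p p' : List A) (y z b : A) (q q' : List A)
    (hy : g y = p ++ b :: q) (hz : g z = p' ++ b :: q') (hne : ¬ (y = z ∧ p.length = p'.length)) :
    False := by
  have L1 : ∀ {x y}, F x ≠ F y → La x ≠ La y := core_lemma1 hg hT hF hL hnc
  have L2 := @core_lemma2 _ _ g F La hcard hg hT hF hL hnc hns
  have hfirst : ∀ y b q, g y = b :: q → F y = b := by
    intro y b q h
    obtain ⟨r, hr⟩ := hF y
    rw [hr] at h
    exact (List.cons.inj h).1
  induction p using List.reverseRecOn generalizing p' b q q' with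
  | nil =>
    rcases List.eq_nil_or_concat' p' with rfl | ⟨p', e', rfl⟩
    · simp at hne hy hz
      obtain ⟨x, hx⟩ := hns b
      have hFy := hfirst _ _ _ hy
      have hFz := hfirst _ _ _ hz
      have hxy : x ≠ y := by rintro rfl; exact hx hFy
      have hxz : x ≠ z := by rintro rfl; exact hx hFz
      have := core_test hg hT hF (x := x) (l1 := [y, z]) (b := b) (e := La x) (e' := La y)
        (by simp [hxy, hxz, hne]) hx.symm
        (Or.inl (by rw [← hFy]; exact adj_infix hF hL [] [z] x y))
        (Or.inl (by rw [← hFz]; exact adj_infix hF hL [x] [] y z))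
      exact L1 (by rw [hFy]; exact hx) this
    · exact L2 (e' := e') (hfirst _ _ _ hy) ⟨p', q', by rw [hz]; simp⟩
  | append_singleton p e ih =>
    rcases List.eq_nil_or_concat' p' with rfl | ⟨p', e', rfl⟩
    · exact L2 (e' := e) (hfirst _ _ _ hz) ⟨p, q, by rw [hy]; simp⟩
    · obtain ⟨x, hx⟩ := hns b
      have := core_test hg hT hF (x := x) (l1 := []) (b := b) (e := e) (e' := e')
        (by simp) hx.symm (Or.inr ⟨y, p, q, by rw [hy]; simp⟩) (Or.inr ⟨z, p', q', by rw [hz]; simp⟩)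
      subst this
      exact ih p' e (b :: q) (b :: q') (by rw [hy]; simp) (by rw [hz]; simp) (by simpa using hne)

theorem core (hcard : 3 ≤ Fintype.card A) (hg : ∀ t, g t ≠ [])
    (hT : ∀ v, IsLSP v → ∀ x, InfImage g v x → IsLSP x)
    (hnc : ∀ x y, x ≠ y → g x ++ g y ≠ g y ++ g x)
    (hns : ¬ ∃ b, ∀ t, ∃ r, g t = b :: r) :
    ∃ π : Equiv.Perm A, ∀ t, g t = [π t] := by
  have hF : ∀ t, ∃ a r, g t = a :: r := fun t => List.exists_cons_of_ne_nil (hg t)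
  choose F hF using hF
  have hL : ∀ t, ∃ a r, g t = r ++ [a] := by
    intro t
    rcases List.eq_nil_or_concat' (g t) with h | ⟨r, a, h⟩
    · exact absurd h (hg t)
    · exact ⟨a, r, h⟩
  choose La hL using hL
  have hns' : ∀ b, ∃ x, F x ≠ b := by
    intro b
    by_contra hcon
    push Not at hcon
    exact hns ⟨b, fun t => by obtain ⟨r, hr⟩ := hF t; exact ⟨r, by rw [hr, hcon t]⟩⟩
  have L3 := core_lemma3 hcard hg hT hF hL hnc hns'
  have hinj : Function.Injective F := by
    intro y z hyz
    by_contra hne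
    obtain ⟨r, hr⟩ := hF y
    obtain ⟨r', hr'⟩ := hF z
    exact L3 [] [] y z (F y) r r' hr (by rw [hr', hyz]; rfl) (by simp [hne])
  have hbij : Function.Bijective F := Finite.injective_iff_bijective.1 hinj
  refine ⟨Equiv.ofBijective F hbij, fun t => ?_⟩
  obtain ⟨r, hr⟩ := hF t
  cases r with
  | nil => simpa using hr
  | cons b r =>
    exfalso
    obtain ⟨t', ht'⟩ := hbij.2 b
    obtain ⟨r', hr'⟩ := hF t'
    exact L3 [] [F t] t' t b r' r (by rw [hr', ht']; rfl) (by rw [hr]; rfl) (by simp)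

end core

theorem fac_single_iff {y : A} {w : ℕ → A} : IsFactorI [y] w ↔ y ∈ Set.range w := by
  constructor
  · rintro ⟨k, hk⟩
    exact ⟨k, by simpa using (hk 0 (by simp)).symm⟩
  · rintro ⟨k, rfl⟩
    refine ⟨k, ?_⟩
    intro i hi
    simp at hi
    subst hi
    simp

def sm (c : A → ℤ) (u : List A) : ℤ := (u.map c).sum

theorem sm_append (c : A → ℤ) (u v : List A) : sm c (u ++ v) = sm c u + sm c v := by
  simp [sm]

theorem sm_cons (c : A → ℤ) (a : A) (v : List A) : sm c (a :: v) = c a + sm c v := by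
  simp [sm]

theorem sm_nil (c : A → ℤ) : sm c [] = 0 := by
  simp [sm]

theorem sm_applyM (c : B → ℤ) (f : A → List B) (u : List A) :
    sm c (applyM f u) = sm (fun t => sm c (f t)) u := by
  induction u with
  | nil => simp [applyM_nil, sm_nil]
  | cons a u ih => simp [applyM_cons, sm_append, sm_cons, ih]

def Bnd (c : A → ℤ) (w : ℕ → A) (b : ℤ) : Prop := ∀ u, IsFactorI u w → |sm c u| ≤ b

theorem Bnd_back {c : B → ℤ} {f : A → List B} {v : ℕ → A} {w : ℕ → B} {b : ℤ}
    (hI : InfImage f v w) (h : Bnd c w b) : Bnd (fun t => sm c (f t)) v b := by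
  intro u hu
  rw [← sm_applyM]
  exact h _ (img_fac hI hu)

section dir
variable [DecidableEq A] {x : ℕ → A} {W : ℕ → ℕ → A}

theorem sm_L (c : A → ℤ) (a t : A) : sm c (Lmor a t) = if t = a then c a else c a + c t := by
  by_cases h : t = a <;> simp [Lmor, h, sm]

def Cseq (x : ℕ → A) (c : A → ℤ) : ℕ → A → ℤ
  | 0 => c
  | n+1 => fun t => sm (Cseq x c n) (Lmor (x n) t)

theorem letters_occur (hW : ∀ n, InfImage (Lmor (x n)) (W (n+1)) (W n))
    (hx : ∀ y m0, ∃ m, m0 ≤ m ∧ x (2^m) = y) (n : ℕ) (y : A) : IsFactorI [y] (W n) := by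
  obtain ⟨m, hm, hy⟩ := hx y n
  have hle : n ≤ 2^m := hm.trans (Nat.lt_two_pow_self).le
  have h0 : IsFactorI [y] (W (2^m)) := by
    rw [fac_single_iff]
    exact ⟨0, by rw [← hy]; exact (tree_L _).zero (hW _)⟩
  clear hy
  generalize 2^m = k at *
  induction k, hle using Nat.le_induction with
  | base => exact h0
  | succ k _ ih =>
    apply ih
    have := img_fac (hW k) h0
    rw [applyM_single] at this
    obtain ⟨l, hl⟩ := (tree_L (x k)).last y
    rw [hl] at this
    exact fac_infix ⟨l, [], by simp⟩ this

theorem Cseq_bnd (hW : ∀ n, InfImage (Lmor (x n)) (W (n+1)) (W n)) {c : A → ℤ} {b : ℤ}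
    (hb : Bnd c (W 0) b) (n : ℕ) : Bnd (Cseq x c n) (W n) b := by
  induction n with
  | zero => exact hb
  | succ n ih => exact Bnd_back (hW n) ih

theorem Cseq_run (c : A → ℤ) (n N : ℕ) (h : ∀ i < N, x (n+i) = x n) :
    Cseq x c (n+N) (x n) = Cseq x c n (x n) ∧
      ∀ y, y ≠ x n → Cseq x c (n+N) y = Cseq x c n y + N * Cseq x c n (x n) := by
  induction N with
  | zero => simp
  | succ N ih =>
    obtain ⟨h1, h2⟩ := ih (fun i hi => h i (by omega))
    have hx := h N (by omega)
    rw [← add_assoc]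
    simp only [Cseq, sm_L, hx]
    refine ⟨by simp [h1], fun y hy => ?_⟩
    rw [if_neg hy, h1, h2 y hy]; push_cast; ring

theorem Cseq_zero_back (c : A → ℤ) (n : ℕ) (h : Cseq x c n = 0) : c = 0 := by
  induction n with
  | zero => exact h
  | succ n ih =>
    apply ih
    have h0 : Cseq x c n (x n) = 0 := by
      have := congrFun h (x n)
      simpa [Cseq, sm_L] using this
    funext y
    by_cases hy : y = x n
    · rw [hy, h0]; rfl
    · have := congrFun h y
      simpa [Cseq, sm_L, hy, h0] using this

theorem dir_zero (hne : ∀ a : A, ∃ b : A, b ≠ a)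
    (hW : ∀ n, InfImage (Lmor (x n)) (W (n+1)) (W n))
    (hx : ∀ y m0, ∃ m, m0 ≤ m ∧ x (2^m) = y)
    (hr : ∀ m i, i < 2^m → x (2^m+i) = x (2^m)) {c : A → ℤ} {b : ℤ}
    (hb : Bnd c (W 0) b) : c = 0 := by
  have hB := Cseq_bnd hW hb
  have hl : ∀ n y, |Cseq x c n y| ≤ b := fun n y => by
    have := hB n [y] (letters_occur hW hx n y)
    simpa [sm] using this
  obtain ⟨m0, hm0⟩ : ∃ m0 : ℕ, 2 * b < m0 := ⟨(2*b).toNat + 1, by push_cast; have := Int.self_le_toNat (2*b); omega⟩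
  have hz : ∀ m, m0 ≤ m → Cseq x c (2^m) (x (2^m)) = 0 := by
    intro m hm
    obtain ⟨y, hy⟩ := hne (x (2^m))
    have h1 := (Cseq_run c (2^m) (2^m) (hr m)).2 y hy
    have h2 := hl (2^m) y
    have h3 := hl (2^m+2^m) y
    rw [h1] at h3
    generalize Cseq x c (2^m) (x (2^m)) = z at *
    have h4 : (m0 : ℤ) ≤ ((2^m : ℕ) : ℤ) := by
      exact_mod_cast hm.trans (Nat.lt_two_pow_self).le
    generalize ((2^m : ℕ) : ℤ) = N at *
    by_contra hz
    have h5 : 1 ≤ |z| := Int.one_le_abs hz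
    have h6 : |N * z| ≤ 2 * b := by
      have : N * z = (Cseq x c (2^m) y + N * z) - Cseq x c (2^m) y := by ring
      rw [this]
      exact (abs_sub _ _).trans (by linarith)
    rw [abs_mul] at h6
    have h7 : N ≤ |N| := le_abs_self N
    nlinarith [abs_nonneg N]
  have hc : ∀ m, m0 ≤ m → Cseq x c (2^(m+1)) = Cseq x c (2^m) := by
    intro m hm
    have e : 2^(m+1) = 2^m + 2^m := by ring
    obtain ⟨h1, h2⟩ := Cseq_run c (2^m) (2^m) (hr m)
    funext y
    rw [e]
    by_cases hy : y = x (2^m)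
    · rw [hy]; exact h1
    · rw [h2 y hy, hz m hm]; simp
  have hd : ∀ m, m0 ≤ m → Cseq x c (2^m) = Cseq x c (2^m0) := by
    intro m hm
    induction m, hm using Nat.le_induction with
    | base => rfl
    | succ m hm ih => rw [hc m hm, ih]
  apply Cseq_zero_back (x := x) c (2^m0)
  funext y
  obtain ⟨m, hm, hy⟩ := hx y m0
  rw [← hd m hm, ← hy, hz m hm]; rfl

theorem dir_zero_F (hne : ∀ a : A, ∃ b : A, b ≠ a)
    (hW : ∀ n, InfImage (Lmor (x n)) (W (n+1)) (W n))
    (hx : ∀ y m0, ∃ m, m0 ≤ m ∧ x (2^m) = y)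
    (hr : ∀ m i, i < 2^m → x (2^m+i) = x (2^m)) {α β γ : A} (h1 : β ≠ α) (h2 : γ ≠ α) (h3 : β ≠ γ)
    {w : ℕ → A} (hw : InfImage (Fmor α β γ) (W 0) w) {c : A → ℤ} {b : ℤ}
    (hb : Bnd c w b) : c = 0 := by
  have h0 := dir_zero hne hW hx hr (Bnd_back hw hb)
  have ha : c α = 0 := by simpa [Fmor, sm] using congrFun h0 α
  have hbb : c β = 0 := by simpa [Fmor, sm, h1, h3, ha] using congrFun h0 β
  funext t
  by_cases e1 : t = α
  · subst e1; exact ha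
  by_cases e2 : t = γ
  · subst e2; simpa [Fmor, sm, h2, ha, hbb] using congrFun h0 t
  · simpa [Fmor, sm, e1, e2, ha] using congrFun h0 t
end dir

def asm (c : A → ℤ) (u : List A) : ℤ := (u.map (fun s => |c s|)).sum

theorem sm_prefix_le (c : A → ℤ) {q u : List A} (h : q <+: u) : |sm c q| ≤ asm c u := by
  induction u generalizing q with
  | nil => simp [List.prefix_nil.1 h, sm, asm]
  | cons a u ih =>
    cases q with
    | nil => 
      simp only [sm, List.map_nil, List.sum_nil, abs_zero, asm]
      apply List.sum_nonneg
      simp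
    | cons a' q =>
      have hc := List.cons_prefix_cons.1 h
      have := ih hc.2
      rw [hc.1]
      simp only [sm, asm, List.map_cons, List.sum_cons] at *
      exact (abs_add_le _ _).trans (by linarith)

theorem sm_pre_bound [Fintype A] (c : B → ℤ) (g : A → List B) (M : List A)
    (hM : ∀ t ∈ M, sm c (g t) = 0) {q : List B} (hq : q <+: applyM g M) :
    |sm c q| ≤ ∑ t : A, asm c (g t) := by
  have hnn : ∀ t, 0 ≤ asm c (g t) := fun t => List.sum_nonneg (by simp)
  induction M generalizing q with
  | nil =>
    rw [applyM_nil] at hq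
    simp only [List.prefix_nil.1 hq, sm, List.map_nil, List.sum_nil, abs_zero]
    exact Finset.sum_nonneg (fun t _ => hnn t)
  | cons a M ih =>
    rw [applyM_cons] at hq
    rcases le_total q.length (g a).length with h | h
    · have h' := List.prefix_of_prefix_length_le hq (List.prefix_append _ _) h
      exact (sm_prefix_le c h').trans
        (Finset.single_le_sum (f := fun t => asm c (g t)) (fun t _ => hnn t) (Finset.mem_univ a))
    · obtain ⟨r, rfl⟩ := List.prefix_of_prefix_length_le (List.prefix_append _ _) hq h
      rw [List.prefix_append_right_inj] at hq
      rw [sm_append, hM a (by simp), zero_add]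
      exact ih (fun t ht => hM t (by simp [ht])) hq

theorem Bnd_of_zero [Fintype A] {c : B → ℤ} {g : A → List B} {v : ℕ → A} {w : ℕ → B}
    (hg : ∀ y ∈ Set.range v, g y ≠ []) (hI : InfImage g v w)
    (h0 : ∀ y ∈ Set.range v, sm c (g y) = 0) : ∃ b, Bnd c w b := by
  refine ⟨2 * ∑ t : A, asm c (g t), fun u hu => ?_⟩
  have hp : ∀ q, IsPrefixI q w → |sm c q| ≤ ∑ t : A, asm c (g t) := by
    intro q hq
    refine sm_pre_bound c g _ ?_ (img_cover hg hI hq)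
    intro t ht
    apply h0
    simp only [infPrefix, List.mem_ofFn] at ht
    obtain ⟨i, rfl⟩ := ht
    exact ⟨_, rfl⟩
  obtain ⟨p, h⟩ := fac_iff.1 hu
  have h1 := hp _ h
  have h2 := hp p (pfx_mono (List.prefix_append _ _) h)
  rw [sm_append] at h1
  have e : sm c u = (sm c p + sm c u) - sm c p := by ring
  rw [e]
  exact (abs_sub _ _).trans (by linarith)

theorem card_of_inj {A : Type*} [Fintype A] {ι : Type*} [Fintype ι] (G : ι → List A)
    (h : ∀ c : A → ℤ, (∀ i, sm c (G i) = 0) → c = 0) : Fintype.card A ≤ Fintype.card ι := by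
  have hadd : ∀ (c d : A → ℤ) (u : List A), sm (c + d) u = sm c u + sm d u := by
    intro c d u
    induction u with
    | nil => simp [sm]
    | cons a u ih => simp only [sm_cons, ih, Pi.add_apply]; ring
  have hmul : ∀ (k : ℤ) (c : A → ℤ) (u : List A), sm (k • c) u = k • sm c u := by
    intro k c u
    induction u with
    | nil => simp [sm]
    | cons a u ih => simp only [sm_cons, ih, Pi.smul_apply, smul_add]
  let φ : (A → ℤ) →ₗ[ℤ] (ι → ℤ) :=
    { toFun := fun c i => sm c (G i)
      map_add' := fun c d => funext fun i => hadd c d _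
      map_smul' := fun k c => funext fun i => hmul k c _ }
  refine card_le_of_injective ℤ φ ?_
  rw [injective_iff_map_eq_zero]
  intro c hc
  exact h c (fun i => congrFun hc i)

theorem comm_sm (c : A → ℤ) (n : ℕ) : ∀ (u v : List A), u.length + v.length ≤ n → u ++ v = v ++ u →
    (v.length : ℤ) * sm c u = u.length * sm c v := by
  induction n with
  | zero =>
    intro u v h _
    have h1 : u = [] := List.length_eq_zero_iff.1 (by omega)
    have h2 : v = [] := List.length_eq_zero_iff.1 (by omega)
    subst h1 h2; simp
  | succ n ih =>
    have key : ∀ u v : List A, u.length ≤ v.length → u.length + v.length ≤ n+1 → u ++ v = v ++ u →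
        (v.length : ℤ) * sm c u = u.length * sm c v := by
      intro u v hle h e
      cases u with
      | nil => simp [sm]
      | cons a u =>
        have hpre : (a :: u) <+: v := List.prefix_of_prefix_length_le
          (List.prefix_append _ v) (by rw [e]; exact List.prefix_append _ _) hle
        obtain ⟨r, rfl⟩ := hpre
        rw [List.append_assoc] at e
        have e' := List.append_cancel_left e
        have := ih (a :: u) r (by simp at h ⊢; omega) e'
        rw [sm_append]
        simp only [List.length_append]
        push_cast
        linarith
    intro u v h e
    rcases le_total u.length v.length with hle | hle
    · exact key u v hle h e
    · exact (key v u hle (by omega) e.symm).symm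

theorem full_range {A : Type*} [Fintype A] {g : A → List A} {v w : ℕ → A}
    (hz : ∀ (c : A → ℤ) b, Bnd c w b → c = 0)
    (hg : ∀ y ∈ Set.range v, g y ≠ []) (hI : InfImage g v w) :
    (∀ y, y ∈ Set.range v) ∧ ∀ x y, x ≠ y → g x ++ g y ≠ g y ++ g x := by
  classical
  have hr : ∀ y, y ∈ Set.range v := by
    have := card_of_inj (ι := Set.range v) (fun i => g i) (by
      intro c hc
      obtain ⟨b, hb⟩ := Bnd_of_zero (c := c) hg hI (fun y hy => hc ⟨y, hy⟩)
      exact hz c b hb)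
    by_contra hcon
    push Not at hcon
    obtain ⟨y, hy⟩ := hcon
    have h2 := Fintype.card_subtype_lt (p := fun z => z ∈ Set.range v) hy
    have h3 : Fintype.card {z // z ∈ Set.range v} = Fintype.card (Set.range v) := by
      exact Fintype.card_congr (Equiv.refl _)
    omega
  refine ⟨hr, fun x y hxy e => ?_⟩
  have := card_of_inj (ι := {t : A // t ≠ y}) (fun i => g i) (by
    intro c hc
    have hgy : sm c (g y) = 0 := by
      have h1 := comm_sm c _ (g x) (g y) le_rfl e
      rw [hc ⟨x, hxy⟩, mul_zero] at h1
      have h2 : ((g x).length : ℤ) ≠ 0 := by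
        have := List.length_pos_iff.2 (hg x (hr x))
        omega
      exact (mul_eq_zero.1 h1.symm).resolve_left h2
    obtain ⟨b, hb⟩ := Bnd_of_zero (c := c) hg hI (fun t _ => by
      by_cases ht : t = y
      · rw [ht]; exact hgy
      · exact hc ⟨t, ht⟩)
    exact hz c b hb)
  have h2 := Fintype.card_subtype_lt (p := fun z => z ≠ y) (x := y) (by simp)
  omega

theorem descend_step [DecidableEq A] {f : A → List A} {α : A} {p : A → A} (T : TreeM f α p)
    {v w w2 : ℕ → A} (hI : InfImage f v w) {h : A → List A} (hne : ∀ t, h t ≠ [])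
    (hr : ∀ y, y ∈ Set.range w2) (hw : InfImage h w2 w)
    (hnc : ∀ x y, x ≠ y → h x ++ h y ≠ h y ++ h x)
    (hs : ∃ b, ∀ t, ∃ r, h t = b :: r) :
    ∃ h' : A → List A, (∀ t, h' t ≠ []) ∧ (∀ t, h t = applyM f (h' t)) ∧ InfImage h' w2 v ∧
      (∀ x y, x ≠ y → h' x ++ h' y ≠ h' y ++ h' x) := by
  obtain ⟨b, hb⟩ := hs
  have hfac : ∀ t, IsFactorI (h t) w := by
    intro t
    have := img_fac hw (fac_single_iff.2 (hr t))
    rwa [applyM_single] at this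
  have hbα : b = α := by
    have h1 := img_pfx hw (pfx_infPrefix w2 1)
    have e : infPrefix w2 1 = [w2 0] := by simp [infPrefix]
    obtain ⟨r, hr⟩ := hb (w2 0)
    rw [e, applyM_single, hr] at h1
    rw [pfx_head h1, T.zero hI]
  subst hbα
  have hex : ∀ t, ∃ l, l ≠ [] ∧ h t = applyM f l := by
    intro t
    have hc := T.chain_fac hI (hfac t)
    obtain ⟨r, hr⟩ := hb t
    rcases List.eq_nil_or_concat' (h t) with h0 | ⟨l, e, he⟩
    · exact absurd h0 (hne t)
    · refine ⟨decM b (l ++ [e]) ++ [e], by simp, ?_⟩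
      rw [he]
      apply T.recon
      · rw [← he]; exact hc
      · rw [← he, hr]; rfl
  choose h' h1 h2 using hex
  refine ⟨h', h1, h2, ?_, ?_⟩
  · obtain ⟨y, hy⟩ := img_exists (f := h') (v := w2) (fun t _ => h1 t)
    have e : h = fun t => applyM f (h' t) := funext h2
    have := img_decomp (f := f) (fun t _ => h1 t) hy (by rw [← e]; exact hw)
    rwa [T.inj hI this]
  · intro x y hxy e
    apply hnc x y hxy
    rw [h2, h2, ← applyM_append, ← applyM_append, e]

theorem L_len [DecidableEq A] (a : A) (l : List A) : l.length ≤ (applyM (Lmor a) l).length ∧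
    ((applyM (Lmor a) l).length ≤ l.length → l = List.replicate l.length a) := by
  induction l with
  | nil => simp [applyM]
  | cons s l ih =>
    rw [applyM_cons]
    by_cases h : s = a
    · subst h
      have e : Lmor s s = [s] := by simp [Lmor]
      rw [e]
      simp only [List.length_append, List.length_cons, List.length_nil]
      refine ⟨by have := ih.1; omega, fun h => ?_⟩
      have := ih.2 (by omega)
      rw [List.replicate_succ, ← this]
    · have e : Lmor a s = [a, s] := by simp [Lmor, h]
      rw [e]
      simp only [List.length_append, List.length_cons, List.length_nil]
      have := ih.1
      exact ⟨by omega, fun h => by omega⟩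

theorem descent [Fintype A] [DecidableEq A] (hcard : 3 ≤ Fintype.card A)
    {x : ℕ → A} {W : ℕ → ℕ → A} (hW : ∀ n, InfImage (Lmor (x n)) (W (n+1)) (W n))
    {w2 : ℕ → A} (hr : ∀ y, y ∈ Set.range w2) {α b c : A} (hb : b ≠ α) (hc : c ≠ α) (hbc : b ≠ c)
    (N : ℕ) : ∀ (n : ℕ) (h : A → List A), ∑ t, (h t).length = N → (∀ t, h t ≠ []) →
      (∀ x y, x ≠ y → h x ++ h y ≠ h y ++ h x) → InfImage h w2 (W n) →
      (∀ v, IsLSP v → ∀ y, InfImage h v y → IsLSP y ∧ ¬ Fragile y α b c) → False := by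
  induction N using Nat.strong_induction_on with
  | _ N ih =>
  intro n h hN hne hnc hI hT
  by_cases hs : ∃ b, ∀ t, ∃ r, h t = b :: r
  · obtain ⟨h', h1, h2, h3, h4⟩ := descend_step (tree_L (x n)) (hW n) hne hr hI hnc hs
    refine ih (∑ t, (h' t).length) ?_ (n+1) h' rfl h1 h4 h3 ?_
    · rw [← hN]
      apply Finset.sum_lt_sum
      · intro t _; rw [h2]; exact (L_len _ _).1
      · by_contra hcon
        push Not at hcon
        have hp : ∀ t, h' t = List.replicate (h' t).length (x n) := fun t =>
          (L_len _ _).2 (by rw [← h2]; exact hcon t (Finset.mem_univ _))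
        apply h4 b c hbc
        rw [hp b, hp c, ← List.replicate_add, ← List.replicate_add, add_comm]
    · intro v hv y hy
      obtain ⟨z, hz⟩ := img_exists (f := Lmor (x n)) (v := y) (fun t _ => (tree_L (x n)).ne_nil t)
      have hc := img_comp hy hz
      have e : h = fun t => applyM (Lmor (x n)) (h' t) := funext h2
      rw [← e] at hc
      obtain ⟨g1, g2⟩ := hT v hv z hc
      exact ⟨(tree_L (x n)).lsp_back hz g1, fun hf => g2 (frag_L hz hf)⟩
  · obtain ⟨π, hπ⟩ := core hcard hne (fun v hv y hy => (hT v hv y hy).1) hnc hs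
    have hl : ([π.symm α, π.symm b, π.symm c] : List A) ≠ [] := by simp
    have hnd : ([π.symm α, π.symm b, π.symm c] : List A).Nodup := by
      simp [hb.symm, hc.symm, hbc]
    obtain ⟨y, hy⟩ := img_exists (f := h) (v := cyc _ hl) (fun t _ => hne t)
    refine (hT _ (cyc_lsp _ hl hnd) y hy).2 ?_
    have hfac : IsFactorI [α, b, c] y := by
      have := img_fac hy (fac_of_pfx (cyc_pfx _ hl))
      simpa [applyM, hπ] using this
    have hpf : IsPrefixI [α, b, c] y := by
      have := img_pfx hy (cyc_pfx _ hl)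
      simpa [applyM, hπ] using this
    exact ⟨[], α, b, hb.symm, pfx_mono ⟨[b, c], rfl⟩ hpf, fac_infix ⟨[], [c], rfl⟩ hfac,
      fac_infix ⟨[α], [], rfl⟩ hfac⟩

theorem exists_dir [Fintype A] (h : 0 < Fintype.card A) :
    ∃ x : ℕ → A, (∀ y m0, ∃ m, m0 ≤ m ∧ x (2^m) = y) ∧
      ∀ m i, i < 2^m → x (2^m+i) = x (2^m) := by
  let e := Fintype.equivFin A
  refine ⟨fun n => e.symm ⟨Nat.log 2 n % Fintype.card A, Nat.mod_lt _ h⟩, ?_, ?_⟩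
  · intro y m0
    refine ⟨(e y).1 + Fintype.card A * m0, ?_, ?_⟩
    · nlinarith
    · rw [Equiv.symm_apply_eq]
      ext
      simp [Nat.mod_eq_of_lt (e y).2]
  · intro m i hi
    have : Nat.log 2 (2^m+i) = Nat.log 2 (2^m) := by
      rw [Nat.log_pow (by norm_num)]
      rw [Nat.log_eq_iff (by right; exact ⟨by norm_num, by positivity⟩)]
      constructor
      · omega
      · rw [pow_succ]; omega
    simp only [this]

theorem main_contra [Fintype A] (hcard : 3 ≤ Fintype.card A)
    (S : Set (A → List A)) (hS : ∀ w : ℕ → A,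
      IsLSP w ↔ ∃ (fs : ℕ → (A → List A)) (ws : ℕ → (ℕ → A)),
        ws 0 = w ∧ ∀ n : ℕ, fs n ∈ S ∧
          (∀ y ∈ Set.range (ws (n + 1)), fs n y ≠ []) ∧
          InfImage (fs n) (ws (n + 1)) (ws n)) : False := by
  classical
  obtain ⟨x, hx, hrun⟩ := exists_dir (A := A) (by omega)
  obtain ⟨W, hW⟩ := W_exists x
  obtain ⟨α, b, c, hb, hc, hbc⟩ := Fintype.two_lt_card_iff.1 (show 2 < Fintype.card A by omega)
  have T := tree_F hb.symm hc.symm hbc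
  obtain ⟨w, hw⟩ := img_exists (f := Fmor α b c) (v := W 0) (fun t _ => T.ne_nil t)
  have hlsp : IsLSP w := T.lsp hw (fun u => SP_chain hW u 0)
  have hz : ∀ (c : A → ℤ) b, Bnd c w b → c = 0 := by
    intro c' b' h
    refine dir_zero_F ?_ hW hx hrun hb.symm hc.symm hbc hw h
    intro a
    by_cases e : α = a
    · exact ⟨b, by rw [← e]; exact hb.symm⟩
    · exact ⟨α, e⟩
  obtain ⟨fs, ws, h0, hn⟩ := (hS w).1 hlsp
  obtain ⟨hgS, hg, hI⟩ := hn 0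
  rw [h0] at hI
  obtain ⟨hr, hnc⟩ := full_range hz hg hI
  generalize fs 0 = g at *
  generalize ws (0+1) = w2 at *
  have hne : ∀ t, g t ≠ [] := fun t => hg t (hr t)
  have hT : ∀ v, IsLSP v → ∀ y, InfImage g v y → IsLSP y := by
    intro v hv y hy
    obtain ⟨fs, ws, e0, hn⟩ := (hS v).1 hv
    refine (hS y).2 ⟨fun n => Nat.casesOn n g fs, fun n => Nat.casesOn n y ws, rfl, ?_⟩
    intro n
    cases n with
    | zero => exact ⟨hgS, fun t _ => hne t, by simpa [e0] using hy⟩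
    | succ n => exact hn n
  by_cases hs : ∃ b, ∀ t, ∃ r, g t = b :: r
  · obtain ⟨h, h1, h2, h3, h4⟩ := descend_step T hw hne hr hI hnc hs
    refine descent hcard hW hr hb.symm hc.symm hbc _ 0 h rfl h1 h4 h3 ?_
    intro v hv y hy
    obtain ⟨z, hz⟩ := img_exists (f := Fmor α b c) (v := y) (fun t _ => T.ne_nil t)
    have hcm := img_comp hy hz
    have e : g = fun t => applyM (Fmor α b c) (h t) := funext h2
    rw [← e] at hcm
    have g1 := hT v hv z hcm
    exact ⟨T.lsp_back hz g1, fun hf => frag_F hb.symm hc.symm hbc hz hf g1⟩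
  · obtain ⟨π, hπ⟩ := core hcard hne hT hnc hs
    let u : ℕ → A := fun n => if n = 0 then α else b
    have hu : IsLSP u := by
      refine (hS u).2 ⟨fun _ => g, fun n i => (π.symm)^[n] (u i), rfl, fun n => ⟨hgS, fun t _ => hne t, ?_⟩⟩
      intro k
      have e : ∀ l, applyM g l = l.map π := by
        intro l
        induction l with
        | nil => simp [applyM]
        | cons a l ih => simp [applyM_cons, ih, hπ]
      rw [e]
      intro i hi
      have e2 : ∀ z, π (π.symm^[n+1] z) = π.symm^[n] z := by
        intro z
        rw [Function.iterate_succ_apply', Equiv.apply_symm_apply]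
      simpa [infPrefix, -Function.iterate_succ] using e2 (u i)
    have hls : LeftSpecialI [b] u := by
      refine ⟨α, b, hb, ⟨0, ?_⟩, ⟨1, ?_⟩⟩
      · intro i hi
        simp at hi
        interval_cases i <;> simp [u]
      · intro i hi
        simp at hi
        interval_cases i <;> simp [u]
    have := pfx_head (hu _ hls)
    simp [u] at this
    exact hb this.symm

end LSPProof


/-- for an alphabet with at least three letters, there is no set
`S` of nonerasing morphisms (between free monoids over subalphabets of `A`,
a morphism with domain subalphabet `D` being encoded by sending letters outside
`D` to `[]`) such that the infinite LSP words are exactly the `S`-adic words. -/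
theorem no_S_adic_characterization {A : Type*} [Fintype A]
    (h3 : 3 ≤ Fintype.card A) :
    ¬ ∃ S : Set (A → List A), ∀ w : ℕ → A,
      IsLSP w ↔ ∃ (fs : ℕ → (A → List A)) (ws : ℕ → (ℕ → A)),
        ws 0 = w ∧ ∀ n : ℕ, fs n ∈ S ∧
          (∀ y ∈ Set.range (ws (n + 1)), fs n y ≠ []) ∧
          InfImage (fs n) (ws (n + 1)) (ws n) := by
  rintro ⟨S, hS⟩
  exact main_contra h3 S hS
end
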